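/- arXiv:2502.03816 — 3 statements merged into one kernel-verified Lean document; each statement's English description precedes it below -/
import Mathlib

section
/- Let ι be a set, F an ultrafilter on ι, and (K_i)_{i∈ι} a family of algebraically closed fields. Then the ultraproduct ulim_i K_i = (∏_{i∈ι} K_i)/I_F is an algebraically closed field, i.e., it is a field in which every monic polynomial of positive degree has a root. -/
/-- The ideal of the product ring `Π i, K i` consisting of sequences vanishing on a set
belonging to the ultrafilter `F`. The quotient by this ideal is the ultraproduct. -/
def ultraIdeal {ι : Type*} (F : Ultrafilter ι) (K : ι → Type*) [∀ i, CommRing (K i)] :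
    Ideal (Π i, K i) where
  carrier := { f | { i | f i = 0 } ∈ F }
  zero_mem' := Filter.mem_of_superset Filter.univ_mem (fun i _ => rfl)
  add_mem' := by
    intro a b ha hb
    filter_upwards [ha, hb] with i h1 h2
    simp [h1, h2]
  smul_mem' := by
    intro c a ha
    filter_upwards [ha] with i h
    simp [h]

theorem mem_ultraIdeal {ι : Type*} {F : Ultrafilter ι} {K : ι → Type*} [∀ i, CommRing (K i)]
    {f : Π i, K i} : f ∈ ultraIdeal F K ↔ ∀ᶠ i in F, f i = 0 :=
  Iff.rfl

/-- The ultraproduct of a family of fields is a field. -/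
theorem ultraproduct_isField {ι : Type*} (F : Ultrafilter ι) (K : ι → Type*)
    [∀ i, Field (K i)] : IsField ((Π i, K i) ⧸ ultraIdeal F K) where
  exists_pair_ne := by
    refine ⟨0, Ideal.Quotient.mk _ 1, fun h => ?_⟩
    have h1 := mem_ultraIdeal.1 (Ideal.Quotient.eq_zero_iff_mem.1 h.symm)
    obtain ⟨i, hi⟩ := h1.exists
    exact one_ne_zero hi
  mul_comm := mul_comm
  mul_inv_cancel := by
    intro a ha
    obtain ⟨f, rfl⟩ := Ideal.Quotient.mk_surjective a
    rw [Ne, Ideal.Quotient.eq_zero_iff_mem, mem_ultraIdeal, ← Ultrafilter.eventually_not] at ha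
    refine ⟨Ideal.Quotient.mk _ fun i => (f i)⁻¹, ?_⟩
    rw [← map_mul, ← map_one (Ideal.Quotient.mk _), Ideal.Quotient.mk_eq_mk_iff_sub_mem,
      mem_ultraIdeal]
    filter_upwards [ha] with i hi
    simp [mul_inv_cancel₀ hi]

/-- Over a product of algebraically closed fields, every monic polynomial of positive degree
has a root. -/
theorem Polynomial.Monic.exists_eval_eq_zero_of_pi {ι : Type*} {K : ι → Type*}
    [∀ i, Field (K i)] [∀ i, IsAlgClosed (K i)] {q : Polynomial (Π i, K i)}
    (hq : q.Monic) (hdeg : 0 < q.degree) : ∃ x, Polynomial.eval x q = 0 := by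
  have hroot (i : ι) : ∃ x, Polynomial.IsRoot (q.map (Pi.evalRingHom K i)) x := by
    apply IsAlgClosed.exists_root
    rw [hq.degree_map]
    exact hdeg.ne'
  choose x hx using hroot
  use x
  funext i
  have h := Polynomial.eval_map_apply (f := Pi.evalRingHom K i) (p := q) x
  exact h.symm.trans (hx i)

/-- The ultraproduct of a family of algebraically closed fields along an ultrafilter is an
algebraically closed field: it is a field and every monic polynomial of positive degree
over it has a root. -/
theorem ultraproduct_algClosed {ι : Type*} (F : Ultrafilter ι) (K : ι → Type*)
    [∀ i, Field (K i)] [∀ i, IsAlgClosed (K i)] :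
    IsField ((Π i, K i) ⧸ ultraIdeal F K) ∧
      ∀ p : Polynomial ((Π i, K i) ⧸ ultraIdeal F K), p.Monic → 0 < p.degree →
        ∃ x, Polynomial.eval x p = 0 := by
  refine ⟨ultraproduct_isField F K, fun p hp hdeg => ?_⟩
  have : Nontrivial ((Π i, K i) ⧸ ultraIdeal F K) := (ultraproduct_isField F K).nontrivial
  obtain ⟨q, rfl, hq, hmonic⟩ := Polynomial.lifts_and_degree_eq_and_monic
    (Polynomial.map_surjective _ Ideal.Quotient.mk_surjective p) hp
  obtain ⟨x, hx⟩ := hmonic.exists_eval_eq_zero_of_pi (hq ▸ hdeg)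
  exact ⟨Ideal.Quotient.mk _ x, by rw [Polynomial.eval_map_apply, hx, map_zero]⟩
end

section
/- Let f : R → S be a pure homomorphism of commutative rings. Then the induced map Spec S → Spec R is surjective: for every prime ideal 𝔭 of R there exists a prime ideal 𝔮 of S with f^{-1}(𝔮) = 𝔭. -/
open scoped TensorProduct

universe u v

/-- A ring homomorphism `f : R → S` between commutative rings is pure if for every
`R`-module `M` the canonical map `M → M ⊗[R] S`, `m ↦ m ⊗ 1`, is injective, where `S` is
regarded as an `R`-module via `f`. -/
def RingHom.IsPure {R : Type u} {S : Type v} [CommRing R] [CommRing S] (f : R →+* S) : Prop :=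
  ∀ (M : Type u) [AddCommGroup M] [Module R M],
    letI : Algebra R S := f.toAlgebra
    Function.Injective (fun m : M => m ⊗ₜ[R] (1 : S))

/-- If `f : R → S` is a pure homomorphism of commutative rings, then `Spec S → Spec R` is
surjective: every prime ideal of `R` is the contraction of a prime ideal of `S`. -/
theorem specMap_surjective_of_isPure {R : Type u} {S : Type v} [CommRing R] [CommRing S]
    (f : R →+* S) (hf : f.IsPure) :
    ∀ p : Ideal R, p.IsPrime → ∃ q : Ideal S, q.IsPrime ∧ q.comap f = p := by
  intro p hp
  let : Algebra R S := f.toAlgebra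
  have hinj := hf p.ResidueField
  have : Nontrivial (p.Fiber S) :=
    nontrivial_of_ne ((1 : p.ResidueField) ⊗ₜ[R] (1 : S)) ((0 : p.ResidueField) ⊗ₜ[R] (1 : S))
      (hinj.ne one_ne_zero)
  obtain ⟨q, hq⟩ := (PrimeSpectrum.nontrivial_iff_mem_rangeComap (S := S) ⟨p, hp⟩).mp this
  exact ⟨q.asIdeal, q.isPrime, congrArg PrimeSpectrum.asIdeal hq⟩
end

section
/- Let A → B be a homomorphism of commutative Noetherian rings. Then A → B is pure if and only if for every prime ideal 𝔭 of A there exists a prime ideal 𝔮 of B lying over 𝔭 (i.e., the preimage of 𝔮 in A is 𝔭) such that the induced local homomorphism A_𝔭 → B_𝔮 between the localizations is pure. -/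
open scoped TensorProduct

universe u v

/-- Every local ring has an injective module containing a copy of the residue field, generated by
the nonzero element `e`. -/
theorem IsLocalRing.exists_injective_ne_zero (R : Type u) [CommRing R] [IsLocalRing R] :
    ∃ (E : Type u) (_ : AddCommGroup E) (_ : Module R E) (e : E), Module.Injective R E ∧
      e ≠ 0 ∧ ∀ r ∈ maximalIdeal R, r • e = 0 := by
  let J : ModuleCat.{u} R := CategoryTheory.Injective.under (ModuleCat.of R (ResidueField R))
  let ι : ModuleCat.of R (ResidueField R) ⟶ J := CategoryTheory.Injective.ι (ModuleCat.of R (ResidueField R))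
  have hι : Function.Injective ι.hom := (ModuleCat.mono_iff_injective ι).1 inferInstance
  refine ⟨J, inferInstance,
    inferInstance, ι.hom (1 : ResidueField R),
    Module.injective_module_of_injective_object R _
      (inj := CategoryTheory.Injective.injective_under _), ?_, fun r hr => ?_⟩
  · exact fun h => one_ne_zero (hι (h.trans (map_zero ι.hom).symm))
  · rw [← map_smul, Algebra.smul_def, mul_one, ResidueField.algebraMap_eq,
      (residue_eq_zero_iff r).2 hr, map_zero]

/-- If `E` is injective and `e ∈ E` is killed by the maximal ideal, then any nonzero element of any
module can be mapped to `e`. -/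
theorem IsLocalRing.exists_linearMap_apply_eq {R : Type u} [CommRing R] [IsLocalRing R]
    {E : Type u} [AddCommGroup E] [Module R E] [Module.Injective R E] {e : E}
    (he : ∀ r ∈ maximalIdeal R, r • e = 0) {M : Type u} [AddCommGroup M] [Module R M]
    {x : M} (hx : x ≠ 0) : ∃ φ : M →ₗ[R] E, φ x = e := by
  have hle : LinearMap.ker (LinearMap.toSpanSingleton R M x) ≤
      LinearMap.ker (LinearMap.toSpanSingleton R E e) := by
    intro r hr
    refine he r fun hu => hx ?_
    exact (hu.smul_eq_zero).1 hr
  obtain ⟨φ, hφ⟩ := Module.Injective.out (Q := E)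
    ((LinearMap.ker (LinearMap.toSpanSingleton R M x)).liftQ (LinearMap.toSpanSingleton R M x)
      le_rfl)
    (LinearMap.ker_eq_bot.1 (Submodule.ker_liftQ_eq_bot' _ _ rfl))
    (Submodule.liftQ _ (LinearMap.toSpanSingleton R E e) hle)
  exact ⟨φ, by
    simpa only [Submodule.liftQ_apply, LinearMap.toSpanSingleton_apply, one_smul] using
      hφ (Submodule.Quotient.mk 1)⟩

/-- An element whose annihilator is contained in `q` stays nonzero after localizing at `q`. -/
theorem IsLocalization.AtPrime.one_tmul_ne_zero {S : Type*} [CommRing S] (q : Ideal S) [q.IsPrime]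
    (S' : Type*) [CommRing S'] [Algebra S S'] [IsLocalization.AtPrime S' q]
    {N : Type*} [AddCommGroup N] [Module S N] {n : N} (h : ∀ s : S, s • n = 0 → s ∈ q) :
    (1 : S') ⊗ₜ[S] n ≠ 0 := by
  intro h0
  obtain ⟨s, hs⟩ := (IsLocalizedModule.eq_zero_iff q.primeCompl (TensorProduct.mk S S' N 1)).1 h0
  exact s.2 (h s hs)

theorem RingHom.isPure_algebraMap_iff {R : Type u} {S : Type v} [CommRing R] [CommRing S]
    [Algebra R S] : (algebraMap R S).IsPure ↔ ∀ (M : Type u) [AddCommGroup M] [Module R M] (m : M),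
      m ⊗ₜ[R] (1 : S) = 0 → m = 0 := by
  have h : (algebraMap R S).toAlgebra = ‹Algebra R S› := Algebra.algebra_ext _ _ fun _ => rfl
  unfold RingHom.IsPure
  rw [h]
  refine forall_congr' fun M => forall_congr' fun _ => forall_congr' fun _ => ?_
  exact injective_iff_map_eq_zero ((TensorProduct.mk R M S).flip 1)

section

variable {R : Type u} {S : Type v} [CommRing R] [CommRing S] [Algebra R S]

/-- If `R → S` is pure, then every prime `p` of `R` is the contraction of a prime `q` of `S` such
that `R_p → S_q` is pure. -/
theorem RingHom.IsPure.exists_prime_isPure (H : (algebraMap R S).IsPure) (p : Ideal R)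
    [p.IsPrime] (R' : Type u) [CommRing R'] [Algebra R R'] [IsLocalization.AtPrime R' p] :
    ∃ (q : Ideal S) (_ : q.IsPrime), p = q.comap (algebraMap R S) ∧
      ∀ (S' : Type v) [CommRing S'] [Algebra S S'] [IsLocalization.AtPrime S' q]
        [Algebra R S'] [IsScalarTower R S S'] [Algebra R' S'] [IsScalarTower R R' S'],
        (algebraMap R' S').IsPure := by
  have := IsLocalization.AtPrime.isLocalRing R' p
  obtain ⟨E, _, _, e, _, he0, he⟩ := IsLocalRing.exists_injective_ne_zero R'
  let : Module R E := Module.compHom E (algebraMap R R')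
  have : IsScalarTower R R' E := IsScalarTower.of_compHom R R' E
  let n : S ⊗[R] E := 1 ⊗ₜ e
  have hn (r : R) : algebraMap R S r • n = 0 ↔ r ∈ p := by
    have h1 : algebraMap R S r • n = 1 ⊗ₜ (r • e) := by
      rw [algebraMap_smul, TensorProduct.tmul_smul]
    rw [h1, ← algebraMap_smul R' r e]
    constructor
    · intro h
      have h2 := RingHom.isPure_algebraMap_iff.1 H E (algebraMap R R' r • e) (by
        simpa only [TensorProduct.comm_tmul, map_zero] using
          congrArg (TensorProduct.comm R S E) h)
      by_contra hr
      exact he0 (((IsLocalization.map_units R' (⟨r, hr⟩ : p.primeCompl)).smul_eq_zero).1 h2)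
    · intro hr
      rw [he _ ((IsLocalization.AtPrime.to_map_mem_maximal_iff R' p r).2 hr),
        TensorProduct.tmul_zero]
  obtain ⟨q, hq, hle, hdis⟩ := Ideal.exists_le_prime_disjoint
    (LinearMap.ker (LinearMap.toSpanSingleton S (S ⊗[R] E) n))
    (p.primeCompl.map (algebraMap R S)) (by
      rw [Set.disjoint_left]
      rintro _ hs ⟨r, hr, rfl⟩
      exact hr ((hn r).1 hs))
  refine ⟨q, hq, ?_, ?_⟩
  · ext r
    refine ⟨fun hr => hle ((hn r).2 hr), fun hr => ?_⟩
    by_contra h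
    exact Set.disjoint_left.1 hdis hr ⟨r, h, rfl⟩
  · intro S' _ _ _ _ _ _ _
    refine RingHom.isPure_algebraMap_iff.2 fun M _ _ m hm => ?_
    by_contra h0
    obtain ⟨φ, hφ⟩ := IsLocalRing.exists_linearMap_apply_eq he h0
    have h1 : e ⊗ₜ[R'] (1 : S') = 0 := by
      simpa [hφ] using congrArg (φ.rTensor S') hm
    have h2 : (1 : S') ⊗ₜ[R] e = 0 := by
      have := IsLocalization.tensorProduct_compatibleSMul p.primeCompl R' E S'
      have h3 := congrArg (TensorProduct.mapOfCompatibleSMul R R' R E S') h1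
      rw [TensorProduct.mapOfCompatibleSMul_tmul, map_zero] at h3
      simpa only [TensorProduct.comm_tmul, map_zero] using
        congrArg (TensorProduct.comm R E S') h3
    refine IsLocalization.AtPrime.one_tmul_ne_zero q S' (n := n) (fun s hs => hle hs) ?_
    apply (TensorProduct.AlgebraTensorModule.cancelBaseChange R S S' S' E).injective
    simpa [n] using h2

end

/-- A ring homomorphism `A → B` is pure if for every maximal ideal `p` of `A` there is a pure
`A_p`-algebra `C` that receives an `A`-algebra homomorphism from `B`. -/
theorem RingHom.isPure_of_forall_isMaximal {A : Type u} {B : Type v}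
    [CommRing A] [CommRing B] [Algebra A B]
    (H : ∀ (p : Ideal A) [p.IsMaximal], ∃ (C : Type v) (_ : CommRing C) (_ : Algebra A C)
      (_ : Algebra (Localization.AtPrime p) C) (_ : IsScalarTower A (Localization.AtPrime p) C),
      Nonempty (B →ₐ[A] C) ∧ (algebraMap (Localization.AtPrime p) C).IsPure) :
    (algebraMap A B).IsPure := by
  refine RingHom.isPure_algebraMap_iff.2 fun M _ _ m hm => ?_
  refine Module.eq_zero_of_localization_maximal (fun (p : Ideal A) _ => LocalizedModule.AtPrime p M)
    (fun (p : Ideal A) _ => LocalizedModule.mkLinearMap p.primeCompl M) m fun p _ => ?_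
  obtain ⟨C, _, _, _, _, ⟨g⟩, hC⟩ := H p
  refine RingHom.isPure_algebraMap_iff.1 hC _ _ ?_
  have h := congrArg (TensorProduct.mapOfCompatibleSMul (Localization.AtPrime p) A A
    (LocalizedModule.AtPrime p M) C) (congrArg (TensorProduct.map
    (LocalizedModule.mkLinearMap p.primeCompl M) g.toLinearMap) hm)
  simpa using h

/-- A homomorphism `A → B` of commutative Noetherian rings is pure if and only if for every
prime `𝔭` of `A` there is a prime `𝔮` of `B` lying over `𝔭` such that the induced local
homomorphism `A_𝔭 → B_𝔮` is pure. -/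
theorem isPure_iff_forall_exists_isPure_localRingHom {A : Type u} {B : Type v}
    [CommRing A] [CommRing B] [IsNoetherianRing A] [IsNoetherianRing B] (f : A →+* B) :
    f.IsPure ↔ ∀ (p : Ideal A) (hp : p.IsPrime),
      ∃ (q : Ideal B) (hq : q.IsPrime) (h : p = q.comap f),
        letI := hp
        letI := hq
        (Localization.localRingHom p q f h).IsPure := by
  algebraize [f]
  constructor
  · intro H p hp
    obtain ⟨q, hq, h, hpure⟩ :=
      RingHom.IsPure.exists_prime_isPure (R := A) (S := B) H p (Localization.AtPrime p)
    refine ⟨q, hq, h, ?_⟩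
    let := (Localization.localRingHom p q f h).toAlgebra
    have : IsScalarTower A (Localization.AtPrime p) (Localization.AtPrime q) :=
      .of_algebraMap_eq fun x => (Localization.localRingHom_to_map p q f h x).symm
    exact hpure (Localization.AtPrime q)
  · intro H
    refine RingHom.isPure_of_forall_isMaximal (A := A) (B := B) fun p _ => ?_
    obtain ⟨q, hq, h, hpure⟩ := H p inferInstance
    let := (Localization.localRingHom p q f h).toAlgebra
    exact ⟨Localization.AtPrime q, inferInstance, inferInstance, inferInstance,
      .of_algebraMap_eq fun x => (Localization.localRingHom_to_map p q f h x).symm,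
      ⟨IsScalarTower.toAlgHom A B _⟩, hpure⟩
end
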